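/- Let λ₄ ∈ ℝ be a constant and let f be a C³ function on an open set U ⊆ ℝ⁴ with f₄₄ nowhere zero on U, satisfying the heavenly equation (case E₁) (f₁₄−f₂₃)f₃₄ + (f₂₂−f₁₃)f₄₄ + (f₃₃−f₂₄)f₂₄ = 0 on U. Then for every λ ∈ ℝ the vector fields X₁(λ) = (λ₄−λ)∂₁ + ∂₂ − (f₂₄(λ₄−λ)/f₄₄)∂₃ + (((λ₄−λ)(f₂₃−f₁₄) − f₂₄)/f₄₄)∂₄ and X₂(λ) = (λ₄−λ)∂₂ + ((f₄₄ − f₃₄(λ₄−λ))/f₄₄)∂₃ + (((λ₄−λ)(f₃₃−f₂₄) − f₃₄)/f₄₄)∂₄ commute on U: [X₁(λ),X₂(λ)] = 0. -/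

import Mathlib

open scoped BigOperators

/-- Partial derivative `∂f/∂x_j` on ℝ⁴ (coordinates `x₁,…,x₄` are indexed by `Fin 4`,
so `x_i` corresponds to index `i-1`). -/
noncomputable def pd (f : (Fin 4 → ℝ) → ℝ) (j : Fin 4) (x : Fin 4 → ℝ) : ℝ :=
  fderiv ℝ f x (Pi.single j 1)

/-- Second partial derivative `∂²f/∂x_i∂x_j` on ℝ⁴. -/
noncomputable def pd2 (f : (Fin 4 → ℝ) → ℝ) (i j : Fin 4) (x : Fin 4 → ℝ) : ℝ :=
  pd (pd f j) i x

/-- Lie bracket of vector fields on ℝ⁴: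
`[X,Y]^i = ∑_j (X^j ∂_j Y^i − Y^j ∂_j X^i)`. -/
noncomputable def lieB (X Y : (Fin 4 → ℝ) → (Fin 4 → ℝ)) (x : Fin 4 → ℝ) : Fin 4 → ℝ :=
  fun i => ∑ j, (X x j * pd (fun y => Y y i) j x - Y x j * pd (fun y => X y i) j x)

section PartialDerivatives

variable {f g : (Fin 4 → ℝ) → ℝ} {x : Fin 4 → ℝ}

theorem pd_const (c : ℝ) (j : Fin 4) (x : Fin 4 → ℝ) : pd (fun _ => c) j x = 0 := by
  simp [pd]

theorem pd_fun_neg (j : Fin 4) : pd (fun y => -f y) j x = -pd f j x := by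
  simp [pd, fderiv_fun_neg]

theorem pd_fun_add (hf : DifferentiableAt ℝ f x) (hg : DifferentiableAt ℝ g x) (j : Fin 4) :
    pd (fun y => f y + g y) j x = pd f j x + pd g j x := by
  simp [pd, fderiv_fun_add hf hg]

theorem pd_fun_sub (hf : DifferentiableAt ℝ f x) (hg : DifferentiableAt ℝ g x) (j : Fin 4) :
    pd (fun y => f y - g y) j x = pd f j x - pd g j x := by
  simp [pd, fderiv_fun_sub hf hg]

theorem pd_fun_mul (hf : DifferentiableAt ℝ f x) (hg : DifferentiableAt ℝ g x) (j : Fin 4) :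
    pd (fun y => f y * g y) j x = f x * pd g j x + g x * pd f j x := by
  simp [pd, fderiv_fun_mul hf hg]

theorem pd_fun_div (hf : DifferentiableAt ℝ f x) (hg : DifferentiableAt ℝ g x) (hx : g x ≠ 0)
    (j : Fin 4) :
    pd (fun y => f y / g y) j x = (g x * pd f j x - f x * pd g j x) / g x ^ 2 := by
  have h : HasFDerivAt (fun y => f y * (g y)⁻¹) _ x :=
    hf.hasFDerivAt.mul ((hasDerivAt_inv hx).comp_hasFDerivAt x hg.hasFDerivAt)
  simp only [pd, div_eq_mul_inv, h.fderiv]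
  simp
  field_simp
  ring

theorem pd_congr_of_eventuallyEq (h : f =ᶠ[nhds x] g) (j : Fin 4) : pd f j x = pd g j x := by
  simp [pd, h.fderiv_eq]

theorem ContDiffAt.pd {m n : WithTop ℕ∞} (hf : ContDiffAt ℝ n f x) (hmn : m + 1 ≤ n)
    (j : Fin 4) : ContDiffAt ℝ m (pd f j) x :=
  (hf.fderiv_right hmn).clm_apply contDiffAt_const

theorem pd2_comm (hf : ContDiffAt ℝ 2 f x) (i j : Fin 4) : pd2 f i j x = pd2 f j i x := by
  have hd : DifferentiableAt ℝ (fderiv ℝ f) x :=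
    (hf.fderiv_right (m := 1) (by norm_num)).differentiableAt (by norm_num)
  have key : ∀ i j, pd2 f i j x =
      fderiv ℝ (fderiv ℝ f) x (Pi.single i 1) (Pi.single j 1) := fun i j => by
    change fderiv ℝ (fun y => fderiv ℝ f y (Pi.single j 1)) x (Pi.single i 1) = _
    rw [fderiv_clm_apply hd (differentiableAt_const _)]
    simp
  rw [key, key]
  exact hf.isSymmSndFDerivAt (by simp) _ _

theorem differentiableAt_pd2 (hf : ContDiffAt ℝ 3 f x) (i j : Fin 4) :
    DifferentiableAt ℝ (pd2 f i j) x :=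
  ((hf.pd (m := 2) (by norm_num) j).pd (m := 1) (by norm_num) i).differentiableAt (by norm_num)

theorem pd_pd2_comm_left (hf : ContDiffAt ℝ 3 f x) (i j k : Fin 4) :
    pd (pd2 f j k) i x = pd (pd2 f i k) j x :=
  pd2_comm (hf.pd (by norm_num) k) i j

theorem pd_pd2_comm_right (hf : ContDiffAt ℝ 3 f x) (i j k : Fin 4) :
    pd (pd2 f j k) i x = pd (pd2 f k j) i x :=
  pd_congr_of_eventuallyEq ((hf.eventually (by simp)).mono fun _ hy =>
    pd2_comm (hy.of_le (by norm_num)) j k) i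

end PartialDerivatives

/-- If `f` is C³ on an open `U ⊆ ℝ⁴` with `f₄₄` nowhere zero and satisfies
the heavenly equation (case E₁) `(f₁₄−f₂₃)f₃₄ + (f₂₂−f₁₃)f₄₄ + (f₃₃−f₂₄)f₂₄ = 0`,
then for every `λ` the Lax pair vector fields `X₁(λ), X₂(λ)` commute on `U`.
(`λ₄` is a real constant, denoted `l4`.) -/
theorem heavenly_E1_lax_pair_commutes
    (l4 : ℝ)
    (U : Set (Fin 4 → ℝ)) (hU : IsOpen U)
    (f : (Fin 4 → ℝ) → ℝ) (hf : ContDiffOn ℝ 3 f U)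
    (hf44 : ∀ x ∈ U, pd2 f 3 3 x ≠ 0)
    (heq : ∀ x ∈ U,
      (pd2 f 0 3 x - pd2 f 1 2 x) * pd2 f 2 3 x
      + (pd2 f 1 1 x - pd2 f 0 2 x) * pd2 f 3 3 x
      + (pd2 f 2 2 x - pd2 f 1 3 x) * pd2 f 1 3 x = 0) :
    ∀ lam : ℝ, ∀ x ∈ U,
      lieB
        (fun y =>
          ![l4 - lam,
            1,
            -(pd2 f 1 3 y * (l4 - lam) / pd2 f 3 3 y),
            ((l4 - lam) * (pd2 f 1 2 y - pd2 f 0 3 y) - pd2 f 1 3 y) / pd2 f 3 3 y])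
        (fun y =>
          ![0,
            l4 - lam,
            (pd2 f 3 3 y - pd2 f 2 3 y * (l4 - lam)) / pd2 f 3 3 y,
            ((l4 - lam) * (pd2 f 2 2 y - pd2 f 1 3 y) - pd2 f 2 3 y) / pd2 f 3 3 y])
        x = 0 := by
  intro lam x hx
  have hU' : U ∈ nhds x := hU.mem_nhds hx
  have hfx : ContDiffAt ℝ 3 f x := hf.contDiffAt hU'
  have hd := differentiableAt_pd2 hfx
  have h0 : pd2 f 3 3 x ≠ 0 := hf44 x hx
  have hE : ∀ k, pd (fun y => (pd2 f 0 3 y - pd2 f 1 2 y) * pd2 f 2 3 y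
      + (pd2 f 1 1 y - pd2 f 0 2 y) * pd2 f 3 3 y
      + (pd2 f 2 2 y - pd2 f 1 3 y) * pd2 f 1 3 y) k x = 0 := fun k => by
    rw [pd_congr_of_eventuallyEq (Filter.eventually_of_mem hU' heq), pd_const]
  have hE2 := hE 2
  have hE3 := hE 3
  have hEx := heq x hx
  simp (disch := fun_prop (disch := assumption)) only [pd_fun_add, pd_fun_sub, pd_fun_mul]
    at hE2 hE3
  have hl := pd_pd2_comm_left hfx
  have hr := pd_pd2_comm_right hfx
  have hlr : ∀ i j k, pd (pd2 f j k) i x = pd (pd2 f j i) k x := fun i j k => by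
    rw [hr, hl, hr]
  simp only [hl, hlr] at hE2 hE3
  funext i
  fin_cases i
  · simp [lieB, pd_const]
  · simp [lieB, pd_const]
  · simp [lieB, Fin.sum_univ_four]
    simp (disch := first | assumption | fun_prop (disch := assumption)) only
      [pd_fun_neg, pd_fun_sub, pd_fun_mul, pd_fun_div, pd_const]
    simp only [hl, hlr]
    linear_combination (norm := (field_simp; ring)) ((l4 - lam) ^ 2 / pd2 f 3 3 x ^ 2) * hE3
      - ((l4 - lam) ^ 2 / pd2 f 3 3 x ^ 3 * pd (pd2 f 3 3) 3 x) * hEx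
  · simp [lieB, Fin.sum_univ_four]
    simp (disch := first | assumption | fun_prop (disch := assumption)) only
      [pd_fun_sub, pd_fun_mul, pd_fun_div, pd_const]
    simp only [hl, hlr]
    linear_combination (norm := (field_simp; ring)) (-(l4 - lam) ^ 2 / pd2 f 3 3 x ^ 2) * hE2
      + ((l4 - lam) ^ 2 / pd2 f 3 3 x ^ 3 * pd (pd2 f 2 3) 3 x) * hEx
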